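/- arXiv:0802.1691 — 2 statements merged into one kernel-verified Lean document; each statement's English description precedes it below -/
import Mathlib

section
/- Let T > 0, let A ⊆ ℝ^{d₁} × ℝ^{d₂} be open and bounded with A ∩ {s = 0} ≠ ∅, and assume that for every (r,s) in the closure Ā and every τ ∈ [0,1] the point (r, τs) lies in Ā (s-sections star-shaped about 0). Let φ = 𝜑 + iχ be continuous on [0,T] × Ā with χ(t,r,s) ≥ c|s|^q for a constant c > 0 and a positive integer q, and let f be of class C^k in a neighborhood of [0,T] × Ā, where k ∈ ℕ. Set c_α(t,r) = ∂_s^α f(t,r,0)/α! for multi-indices α ∈ ℕ^{d₂} with |α| < k, and C_α = sup_{v ∈ ℝ^{d₂}} |v^α| e^{-c|v|^q} for |α| = k. Then for all (t,r,s) ∈ [0,T] × Ā and all ε > 0: |(f(t,r,s) − ∑_{|α| < k} c_α(t,r) s^α) e^{iφ(t,r,s)/ε}| ≤ ε^{k/q} ∑_{|α| = k} (sup_{[0,T] × Ā} |∂_s^α f|) · C_α. -/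
/-- Partial derivative in the `i`-th coordinate direction. -/
noncomputable def pd {E : Type*} [NormedAddCommGroup E] [NormedSpace ℝ E] {m : ℕ}
    (i : Fin m) (f : EuclideanSpace ℝ (Fin m) → E) : EuclideanSpace ℝ (Fin m) → E :=
  fun x => fderiv ℝ f x (EuclideanSpace.single i 1)

/-- Iterated partial derivative `∂^α` associated with the multi-index `α`. -/
noncomputable def mpd {E : Type*} [NormedAddCommGroup E] [NormedSpace ℝ E] {m : ℕ}
    (α : Fin m → ℕ) (f : EuclideanSpace ℝ (Fin m) → E) : EuclideanSpace ℝ (Fin m) → E :=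
  (List.finRange m).foldr (fun i g => (pd i)^[α i] g) f


section helpers
variable {m : ℕ} {V : Set (EuclideanSpace ℝ (Fin m))}

lemma pd_contDiffOn (hV : IsOpen V) {n : ℕ} {g : EuclideanSpace ℝ (Fin m) → ℂ} (i : Fin m)
    (hg : ContDiffOn ℝ ((n + 1 : ℕ) : WithTop ℕ∞) g V) : ContDiffOn ℝ (n : WithTop ℕ∞) (pd i g) V := by
  have h := hg.fderiv_of_isOpen hV (m := (n : WithTop ℕ∞)) (by norm_cast)
  exact h.clm_apply contDiffOn_const

lemma pd_congr (hV : IsOpen V) {g h : EuclideanSpace ℝ (Fin m) → ℂ} (i : Fin m)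
    (hg : Set.EqOn g h V) : Set.EqOn (pd i g) (pd i h) V := by
  intro x hx
  have : g =ᶠ[nhds x] h := hg.eventuallyEq_of_mem (hV.mem_nhds hx)
  simp only [pd, this.fderiv_eq]

lemma pd_comm (hV : IsOpen V) {g : EuclideanSpace ℝ (Fin m) → ℂ} (i j : Fin m)
    (hg : ContDiffOn ℝ ((2 : ℕ) : WithTop ℕ∞) g V) : Set.EqOn (pd i (pd j g)) (pd j (pd i g)) V := by
  intro x hx
  have hgx : ContDiffAt ℝ ((2 : ℕ) : WithTop ℕ∞) g x := hg.contDiffAt (hV.mem_nhds hx)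
  have hs : IsSymmSndFDerivAt ℝ g x := hgx.isSymmSndFDerivAt (by simp)
  have hd : DifferentiableAt ℝ (fderiv ℝ g) x :=
    (hgx.fderiv_right (m := 1) (by norm_cast)).differentiableAt (by simp)
  have key : ∀ a b : Fin m, pd a (pd b g) x =
      fderiv ℝ (fderiv ℝ g) x (EuclideanSpace.single a 1) (EuclideanSpace.single b 1) := by
    intro a b
    have : HasFDerivAt (fun y => fderiv ℝ g y (EuclideanSpace.single b 1)) _ x :=
      hd.hasFDerivAt.clm_apply (hasFDerivAt_const _ x)
    unfold pd
    rw [this.fderiv]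
    simp
  rw [key, key]
  exact hs.eq _ _

lemma pdit_contDiffOn (hV : IsOpen V) {n : ℕ} (i : Fin m) (a : ℕ) :
    ∀ {g : EuclideanSpace ℝ (Fin m) → ℂ},
    ContDiffOn ℝ ((n + a : ℕ) : WithTop ℕ∞) g V → ContDiffOn ℝ (n : WithTop ℕ∞) ((pd i)^[a] g) V := by
  induction a with
  | zero => intro g hg; simpa using hg
  | succ a ih =>
    intro g hg
    rw [Function.iterate_succ_apply]
    exact ih (pd_contDiffOn hV i hg)

lemma pdit_congr (hV : IsOpen V) (i : Fin m) (a : ℕ) {g h : EuclideanSpace ℝ (Fin m) → ℂ}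
    (hg : Set.EqOn g h V) : Set.EqOn ((pd i)^[a] g) ((pd i)^[a] h) V := by
  induction a with
  | zero => simpa using hg
  | succ a ih =>
    rw [Function.iterate_succ_apply', Function.iterate_succ_apply']
    exact pd_congr hV i ih

lemma pdit_comm (hV : IsOpen V) (i j : Fin m) (a : ℕ) :
    ∀ {g : EuclideanSpace ℝ (Fin m) → ℂ}, ContDiffOn ℝ ((1 + a : ℕ) : WithTop ℕ∞) g V →
    Set.EqOn (pd i ((pd j)^[a] g)) ((pd j)^[a] (pd i g)) V := by
  induction a with
  | zero => intro g hg; exact fun x _ => rfl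
  | succ a ih =>
    intro g hg
    rw [Function.iterate_succ_apply, Function.iterate_succ_apply]
    refine (ih (pd_contDiffOn hV j hg)).trans (pdit_congr hV j a (pd_comm hV i j (hg.of_le ?_)))
    norm_cast; omega

/-- partial fold -/
noncomputable def fpd {m : ℕ} (α : Fin m → ℕ) (l : List (Fin m))
    (f : EuclideanSpace ℝ (Fin m) → ℂ) : EuclideanSpace ℝ (Fin m) → ℂ :=
  l.foldr (fun i g => (pd i)^[α i] g) f

lemma fpd_contDiffOn (hV : IsOpen V) (α : Fin m → ℕ) (l : List (Fin m)) :
    ∀ {n : ℕ} {g : EuclideanSpace ℝ (Fin m) → ℂ},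
    ContDiffOn ℝ ((n + (l.map α).sum : ℕ) : WithTop ℕ∞) g V →
    ContDiffOn ℝ (n : WithTop ℕ∞) (fpd α l g) V := by
  induction l with
  | nil => intro n g hg; simpa [fpd] using hg
  | cons j l ih =>
    intro n g hg
    refine pdit_contDiffOn hV j (α j) (ih ?_)
    simpa [add_assoc] using hg

lemma fpd_congr (hV : IsOpen V) (α : Fin m → ℕ) (l : List (Fin m))
    {g h : EuclideanSpace ℝ (Fin m) → ℂ}
    (hg : Set.EqOn g h V) : Set.EqOn (fpd α l g) (fpd α l h) V := by
  induction l with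
  | nil => exact hg
  | cons j l ih => exact pdit_congr hV j _ ih

lemma fpd_add_notMem (α : Fin m → ℕ) (i : Fin m) (l : List (Fin m)) (hi : i ∉ l)
    (g : EuclideanSpace ℝ (Fin m) → ℂ) : fpd (α + Pi.single i 1) l g = fpd α l g := by
  induction l with
  | nil => rfl
  | cons j l ih =>
    simp only [List.mem_cons, not_or] at hi
    have := ih hi.2
    have hj : (α + Pi.single i 1 : Fin m → ℕ) j = α j := by simp [Pi.single_apply, Ne.symm hi.1]
    simp only [fpd, List.foldr_cons, hj] at this ⊢
    rw [this]

lemma fpd_add_mem (hV : IsOpen V) (α : Fin m → ℕ) (i : Fin m) (l : List (Fin m)) (hl : l.Nodup)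
    (hi : i ∈ l) (g : EuclideanSpace ℝ (Fin m) → ℂ)
    (hg : ContDiffOn ℝ ((1 + (l.map α).sum : ℕ) : WithTop ℕ∞) g V) :
    Set.EqOn (fpd (α + Pi.single i 1) l g) (pd i (fpd α l g)) V := by
  induction l with
  | nil => simp at hi
  | cons j l ih =>
    rw [List.nodup_cons] at hl
    by_cases hij : i = j
    · subst hij
      have := fpd_add_notMem α i l hl.1 g
      have hj : (α + Pi.single i 1 : Fin m → ℕ) i = α i + 1 := by simp
      simp only [fpd, List.foldr_cons, hj] at this ⊢
      rw [this, Function.iterate_succ_apply']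
      exact fun x _ => rfl
    · have hil : i ∈ l := by simpa [hij] using hi
      have hj : (α + Pi.single i 1 : Fin m → ℕ) j = α j := by simp [Pi.single_apply, Ne.symm hij]
      have hg' : ContDiffOn ℝ ((1 + α j + (l.map α).sum : ℕ) : WithTop ℕ∞) g V := by
        simpa [add_assoc] using hg
      have h1 := ih hl.2 hil (hg'.of_le (by norm_cast; omega))
      have h2 := pdit_comm hV i j (α j) (fpd_contDiffOn hV α l hg')
      have h3 := pdit_congr hV j (α j) h1
      show Set.EqOn ((pd j)^[(α + Pi.single i 1 : Fin m → ℕ) j] (fpd (α + Pi.single i 1) l g))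
        (pd i ((pd j)^[α j] (fpd α l g))) V
      rw [hj]
      exact h3.trans h2.symm

lemma mpd_eq_fpd (α : Fin m → ℕ) (g : EuclideanSpace ℝ (Fin m) → ℂ) :
    mpd α g = fpd α (List.finRange m) g := rfl

lemma sum_finRange (α : Fin m → ℕ) : ((List.finRange m).map α).sum = ∑ i, α i := by
  rw [← List.ofFn_eq_map, List.sum_ofFn]

lemma mpd_contDiffOn (hV : IsOpen V) (α : Fin m → ℕ) {n k : ℕ} (hk : n + ∑ i, α i ≤ k)
    {g : EuclideanSpace ℝ (Fin m) → ℂ} (hg : ContDiffOn ℝ (k : WithTop ℕ∞) g V) :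
    ContDiffOn ℝ (n : WithTop ℕ∞) (mpd α g) V := by
  rw [mpd_eq_fpd]
  apply fpd_contDiffOn hV
  rw [sum_finRange]
  exact hg.of_le (by exact_mod_cast hk)

lemma mpd_add (hV : IsOpen V) (α : Fin m → ℕ) (i : Fin m) {k : ℕ} (hk : ∑ i, α i < k)
    {g : EuclideanSpace ℝ (Fin m) → ℂ} (hg : ContDiffOn ℝ (k : WithTop ℕ∞) g V) :
    Set.EqOn (mpd (α + Pi.single i 1) g) (pd i (mpd α g)) V := by
  rw [mpd_eq_fpd, mpd_eq_fpd]
  apply fpd_add_mem hV _ _ _ (List.nodup_finRange m) (List.mem_finRange i)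
  rw [sum_finRange]
  exact hg.of_le (by norm_cast; omega)

lemma taylor_abs (k : ℕ) : ∀ (H : ℕ → ℝ → ℂ) (M : ℝ),
    (∀ n < k, ∀ τ ∈ Set.Icc (0:ℝ) 1, HasDerivAt (H n) ((n + 1 : ℂ) * H (n + 1) τ) τ) →
    (∀ τ ∈ Set.Icc (0:ℝ) 1, ‖H k τ‖ ≤ M) →
    ∀ τ ∈ Set.Icc (0:ℝ) 1, ‖H 0 τ - ∑ n ∈ Finset.range k, H n 0 * (τ : ℂ) ^ n‖ ≤ M * τ ^ k := by
  induction k with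
  | zero => intro H M _ hM τ hτ; simpa using hM τ hτ
  | succ k ih =>
    intro H M hH hM
    have h1 := ih (fun n τ => (n + 1 : ℂ) * H (n + 1) τ) ((k + 1) * M) ?_ ?_
    · have hder : ∀ τ ∈ Set.Icc (0:ℝ) 1, HasDerivAt
          (fun τ : ℝ => H 0 τ - ∑ n ∈ Finset.range (k + 1), H n 0 * (τ : ℂ) ^ n)
          (((0 : ℕ) + 1 : ℂ) * H (0 + 1) τ - ∑ n ∈ Finset.range k,
            ((n + 1 : ℂ) * H (n + 1) 0) * (τ : ℂ) ^ n) τ := by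
        intro τ hτ
        have h2 : HasDerivAt (fun τ : ℝ => ∑ n ∈ Finset.range (k + 1), H n 0 * (τ : ℂ) ^ n)
            (∑ n ∈ Finset.range (k + 1), H n 0 * ((n : ℂ) * (τ : ℂ) ^ (n - 1))) τ := by
          apply HasDerivAt.fun_sum
          intro n _
          have := ((hasDerivAt_pow n (τ : ℂ)).comp_ofReal).const_mul (H n 0)
          simpa using this
        have h3 := (hH 0 (by omega) τ hτ).sub h2
        have h4 : ∑ n ∈ Finset.range (k + 1), H n 0 * ((n : ℂ) * (τ : ℂ) ^ (n - 1)) =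
            ∑ n ∈ Finset.range k, ((n + 1 : ℂ) * H (n + 1) 0) * (τ : ℂ) ^ n := by
          rw [Finset.sum_range_succ']
          simp only [Nat.cast_zero, zero_mul, mul_zero, add_zero, Nat.add_sub_cancel]
          apply Finset.sum_congr rfl
          intros; push_cast; ring
        rw [h4] at h3
        exact h3
      intro τ hτ
      have := image_norm_le_of_norm_deriv_right_le_deriv_boundary
        (f := fun τ : ℝ => H 0 τ - ∑ n ∈ Finset.range (k + 1), H n 0 * (τ : ℂ) ^ n)
        (a := 0) (b := 1) (B := fun τ => M * τ ^ (k + 1))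
        (B' := fun τ => ((k + 1) * M) * τ ^ k)
        (fun x hx => (hder x hx).continuousAt.continuousWithinAt)
        (fun x hx => (hder x ⟨hx.1, hx.2.le⟩).hasDerivWithinAt)
        (by
          simp only [Finset.sum_range_succ']
          simp)
        (fun x => by
          have := (hasDerivAt_pow (k + 1) x).const_mul M
          have h5 : M * (((k + 1 : ℕ) : ℝ) * x ^ (k + 1 - 1)) = ((k + 1) * M) * x ^ k := by
            rw [Nat.add_sub_cancel]; push_cast; ring
          rw [h5] at this
          exact this)
        (fun x hx => h1 x ⟨hx.1, hx.2.le⟩)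
        hτ
      exact this
    · intro n hn τ hτ
      have := (hH (n + 1) (by omega) τ hτ).const_mul (n + 1 : ℂ)
      exact this
    · intro τ hτ
      have h := hM τ hτ
      have : ‖(k + 1 : ℂ)‖ = k + 1 := by
        have := Complex.norm_natCast (k + 1)
        push_cast at this; exact this
      rw [norm_mul, this]
      gcongr

lemma mem_pA {n : ℕ} {α : Fin m → ℕ} :
    α ∈ Finset.piAntidiag Finset.univ n ↔ ∑ i, α i = n := by
  simp [Finset.mem_piAntidiag]

lemma sum_shift (n : ℕ) (i : Fin m) (F : (Fin m → ℕ) → ℂ) :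
    ∑ β ∈ Finset.piAntidiag Finset.univ (n + 1), (β i : ℂ) * F β =
    ∑ α ∈ Finset.piAntidiag Finset.univ n, (α i + 1 : ℂ) * F (α + Pi.single i 1) := by
  symm
  refine Finset.sum_bij_ne_zero (fun α _ _ => α + Pi.single i 1) ?_ ?_ ?_ ?_
  · intro α hα _
    simp only [Finset.mem_piAntidiag] at hα ⊢
    simp [Finset.sum_add_distrib, hα.1]
  · intro a _ _ b _ _ h
    exact add_right_cancel h
  · intro β hβ hne
    have hβi : β i ≠ 0 := by
      intro h; simp [h] at hne
    have hadd : (β - Pi.single i 1) + Pi.single i 1 = β := by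
      ext j
      by_cases h : j = i
      · subst h; simp; omega
      · simp [Pi.single_apply, h]
    have h2 : (((β - Pi.single i 1 : Fin m → ℕ) i : ℕ) : ℂ) + 1 = β i := by
      have := congrFun hadd i
      simp at this ⊢
      exact_mod_cast this
    refine ⟨β - Pi.single i 1, ?_, ?_, hadd⟩
    · simp only [Finset.mem_piAntidiag] at hβ ⊢
      refine ⟨?_, by simp⟩
      have h1 := hβ.1
      rw [← hadd] at h1
      simp only [Pi.add_apply, Finset.sum_add_distrib] at h1
      simp at h1
      simpa using h1
    · rw [hadd, h2]; exact hne
  · intro α _ _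
    simp

/-- s^α/α! -/
noncomputable def mono' (s : EuclideanSpace ℝ (Fin m)) (α : Fin m → ℕ) : ℂ :=
  ∏ i, ((s i : ℂ) ^ α i / ((α i).factorial : ℂ))

lemma mono'_add (s : EuclideanSpace ℝ (Fin m)) (α : Fin m → ℕ) (i : Fin m) :
    (α i + 1 : ℂ) * mono' s (α + Pi.single i 1) = mono' s α * s i := by
  unfold mono'
  rw [← Finset.mul_prod_erase _ _ (Finset.mem_univ i), ← Finset.mul_prod_erase _ (fun j => (s j : ℂ) ^ α j / ((α j).factorial : ℂ)) (Finset.mem_univ i)]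
  have : ∏ x ∈ Finset.univ.erase i, (s x : ℂ) ^ (α + Pi.single i 1 : Fin m → ℕ) x / (((α + Pi.single i 1 : Fin m → ℕ) x).factorial : ℂ)
      = ∏ x ∈ Finset.univ.erase i, (s x : ℂ) ^ α x / ((α x).factorial : ℂ) := by
    apply Finset.prod_congr rfl
    intro x hx
    have : (α + Pi.single i 1 : Fin m → ℕ) x = α x := by
      simp [Pi.single_apply, Finset.ne_of_mem_erase hx]
    rw [this]
  rw [this]
  have h1 : (α + Pi.single i 1 : Fin m → ℕ) i = α i + 1 := by simp
  rw [h1, Nat.factorial_succ]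
  have h2 : ((α i).factorial : ℂ) ≠ 0 := by exact_mod_cast (Nat.factorial_ne_zero _)
  have h3 : (α i + 1 : ℂ) ≠ 0 := by exact_mod_cast (Nat.succ_ne_zero (α i))
  push_cast
  field_simp
  ring

/-- Taylor terms along the segment -/
noncomputable def Ht (g : EuclideanSpace ℝ (Fin m) → ℂ) (s : EuclideanSpace ℝ (Fin m)) (n : ℕ)
    (τ : ℝ) : ℂ :=
  ∑ α ∈ Finset.piAntidiag Finset.univ n, mono' s α * mpd α g (τ • s)

lemma fderiv_sum_pd (h : EuclideanSpace ℝ (Fin m) → ℂ) (x s : EuclideanSpace ℝ (Fin m)) :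
    fderiv ℝ h x s = ∑ i, (s i : ℂ) * pd i h x := by
  have hs : s = ∑ i, (s i) • EuclideanSpace.single i (1:ℝ) := by
    ext j
    simp [Pi.single_apply]
  conv_lhs => rw [hs]
  simp [pd]

lemma Ht_deriv (hV : IsOpen V) {k : ℕ} {g : EuclideanSpace ℝ (Fin m) → ℂ}
    (hg : ContDiffOn ℝ (k : WithTop ℕ∞) g V) (s : EuclideanSpace ℝ (Fin m)) (n : ℕ) (hn : n < k)
    (τ : ℝ) (hτ : τ • s ∈ V) :
    HasDerivAt (Ht g s n) ((n + 1 : ℂ) * Ht g s (n + 1) τ) τ := by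
  have h1 : HasDerivAt (Ht g s n)
      (∑ α ∈ Finset.piAntidiag Finset.univ n, mono' s α * fderiv ℝ (mpd α g) (τ • s) s) τ := by
    unfold Ht
    apply HasDerivAt.fun_sum
    intro α hα
    apply HasDerivAt.const_mul
    have hα' := mem_pA.1 hα
    have hd : DifferentiableAt ℝ (mpd α g) (τ • s) :=
      ((mpd_contDiffOn hV α (n := 1) (k := k) (by omega) hg).contDiffAt
        (hV.mem_nhds hτ)).differentiableAt (by simp)
    have hl : HasDerivAt (fun τ : ℝ => τ • s) s τ := by
      simpa using (hasDerivAt_id τ).smul_const s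
    exact hd.hasFDerivAt.comp_hasDerivAt τ hl
  convert h1 using 1
  have h2 : (n + 1 : ℂ) * Ht g s (n + 1) τ =
      ∑ i, ∑ β ∈ Finset.piAntidiag Finset.univ (n + 1), (β i : ℂ) * (mono' s β * mpd β g (τ • s)) := by
    rw [Finset.sum_comm]
    unfold Ht
    rw [Finset.mul_sum]
    apply Finset.sum_congr rfl
    intro β hβ
    simp only [Finset.mem_piAntidiag] at hβ
    rw [← Finset.sum_mul]
    congr 1
    have := hβ.1
    exact_mod_cast this.symm
  rw [h2]
  simp only [sum_shift]
  rw [Finset.sum_comm]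
  apply Finset.sum_congr rfl
  intro α hα
  have hα' := mem_pA.1 hα
  rw [fderiv_sum_pd, Finset.mul_sum]
  apply Finset.sum_congr rfl
  intro i _
  rw [← mul_assoc, mono'_add, mpd_add hV α i (by omega) hg hτ, mul_assoc]

lemma sum_fin_eq (k n : ℕ) (hn : n ≤ k) {R : Type*} [AddCommMonoid R] (F : (Fin m → ℕ) → R) :
    ∑ α ∈ Finset.univ.filter (fun α : Fin m → Fin (k + 1) => ∑ i, (α i : ℕ) = n),
      F (fun i => (α i : ℕ)) = ∑ α ∈ Finset.piAntidiag Finset.univ n, F α := by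
  refine Finset.sum_bij (fun α _ => fun i => (α i : ℕ)) ?_ ?_ ?_ ?_
  · intro α hα
    simpa using hα
  · intro a _ b _ h
    funext i
    exact Fin.ext (congrFun h i)
  · intro β hβ
    have hβ' := mem_pA.1 hβ
    have hle : ∀ i, β i < k + 1 := fun i => by
      have := Finset.single_le_sum (f := β) (fun _ _ => Nat.zero_le _) (Finset.mem_univ i)
      omega
    exact ⟨fun i => ⟨β i, hle i⟩, by simpa using hβ', rfl⟩
  · intros; rfl

lemma sum_fin_lt (k : ℕ) {R : Type*} [AddCommMonoid R] (F : (Fin m → ℕ) → R) :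
    ∑ α ∈ Finset.univ.filter (fun α : Fin m → Fin (k + 1) => ∑ i, (α i : ℕ) < k),
      F (fun i => (α i : ℕ)) =
    ∑ n ∈ Finset.range k, ∑ α ∈ Finset.piAntidiag Finset.univ n, F α := by
  rw [← Finset.sum_fiberwise_of_maps_to (t := Finset.range k)
    (g := fun α : Fin m → Fin (k + 1) => ∑ i, (α i : ℕ)) (by intro α hα; simpa using hα)]
  apply Finset.sum_congr rfl
  intro n hn
  have hn' := Finset.mem_range.1 hn
  rw [← sum_fin_eq k n hn'.le, Finset.filter_filter]
  apply Finset.sum_congr _ (fun _ _ => rfl)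
  ext α
  simp only [Finset.mem_filter, Finset.mem_univ, true_and]
  omega

lemma norm_mono'_le (s : EuclideanSpace ℝ (Fin m)) (α : Fin m → ℕ) :
    ‖mono' s α‖ ≤ |∏ i, s i ^ α i| := by
  unfold mono'
  rw [norm_prod, Finset.abs_prod]
  apply Finset.prod_le_prod
  · intros; positivity
  · intro i _
    rw [norm_div, norm_pow, Complex.norm_natCast, Complex.norm_real, abs_pow, Real.norm_eq_abs]
    apply div_le_self (by positivity)
    exact_mod_cast Nat.succ_le_of_lt (Nat.factorial_pos _)

lemma taylor_mv (hV : IsOpen V) {k : ℕ} {g : EuclideanSpace ℝ (Fin m) → ℂ}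
    (hg : ContDiffOn ℝ (k : WithTop ℕ∞) g V) (s : EuclideanSpace ℝ (Fin m))
    (hs : ∀ τ ∈ Set.Icc (0:ℝ) 1, τ • s ∈ V) (S : (Fin m → ℕ) → ℝ)
    (hS : ∀ α : Fin m → ℕ, ∑ i, α i = k → ∀ τ ∈ Set.Icc (0:ℝ) 1, ‖mpd α g (τ • s)‖ ≤ S α) :
    ‖g s - ∑ n ∈ Finset.range k, ∑ α ∈ Finset.piAntidiag Finset.univ n,
      (mpd α g 0 / (∏ i, ((α i).factorial : ℂ))) * ∏ i, (s i : ℂ) ^ (α i)‖ ≤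
    ∑ α ∈ Finset.piAntidiag Finset.univ k, S α * |∏ i, s i ^ α i| := by
  have h := taylor_abs k (Ht g s) (∑ α ∈ Finset.piAntidiag Finset.univ k, S α * |∏ i, s i ^ α i|)
    (fun n hn τ hτ => Ht_deriv hV hg s n hn τ (hs τ hτ)) ?_ 1 (by simp)
  · have h0 : Ht g s 0 1 = g s := by
      have : mpd (0 : Fin m → ℕ) g = g := by
        unfold mpd
        induction List.finRange m with
        | nil => rfl
        | cons j l ih => simpa using ih
      simp [Ht, mono', this]
    rw [h0] at h
    simp only [one_pow, mul_one, Complex.ofReal_one] at h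
    refine le_trans (le_of_eq ?_) h
    congr 2
    apply Finset.sum_congr rfl
    intro n _
    unfold Ht
    apply Finset.sum_congr rfl
    intro α _
    rw [zero_smul, mono', Finset.prod_div_distrib]
    ring
  · intro τ hτ
    unfold Ht
    refine (norm_sum_le _ _).trans (Finset.sum_le_sum ?_)
    intro α hα
    simp only [Finset.mem_piAntidiag] at hα
    rw [norm_mul, mul_comm]
    have h1 := hS α hα.1 τ hτ
    exact mul_le_mul h1 (norm_mono'_le s α) (norm_nonneg _) ((norm_nonneg _).trans h1)

lemma Calpha_bdd (k q : ℕ) (hq : 1 ≤ q) (c : ℝ) (hc : 0 < c) (α : Fin m → ℕ) (hα : ∑ i, α i = k) :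
    BddAbove (Set.range fun v : EuclideanSpace ℝ (Fin m) =>
      |∏ i, v i ^ α i| * Real.exp (-c * ‖v‖ ^ q)) := by
  refine ⟨1 + k.factorial / c ^ k, ?_⟩
  rintro _ ⟨v, rfl⟩
  have h1 : |∏ i, v i ^ α i| ≤ ‖v‖ ^ k := by
    rw [Finset.abs_prod, ← hα, ← Finset.prod_pow_eq_pow_sum]
    apply Finset.prod_le_prod
    · intros; positivity
    · intro i _
      rw [abs_pow]
      have := PiLp.norm_apply_le v i
      rw [Real.norm_eq_abs] at this
      gcongr
  have h2 : ‖v‖ ^ k ≤ 1 + (‖v‖ ^ q) ^ k := by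
    rcases le_total ‖v‖ 1 with h | h
    · have := pow_le_one₀ (norm_nonneg v) h (n := k)
      have : 0 ≤ (‖v‖ ^ q) ^ k := by positivity
      linarith
    · have h3 : ‖v‖ ^ k ≤ (‖v‖ ^ q) ^ k := by
        gcongr
        exact le_self_pow₀ h (by omega)
      linarith
  set y := ‖v‖ ^ q with hy
  have hy0 : 0 ≤ y := by positivity
  have h4 := Real.pow_div_factorial_le_exp (c * y) (by positivity) k
  have h5 : y ^ k * Real.exp (-c * y) ≤ k.factorial / c ^ k := by
    have hf : (0:ℝ) < k.factorial := by exact_mod_cast Nat.factorial_pos k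
    rw [neg_mul, Real.exp_neg, le_div_iff₀ (by positivity), ← div_eq_mul_inv, div_mul_eq_mul_div,
      div_le_iff₀ (Real.exp_pos _)]
    rw [div_le_iff₀ hf, mul_pow] at h4
    linarith
  have h6 : Real.exp (-c * y) ≤ 1 := Real.exp_le_one_iff.2 (by nlinarith)
  calc _ ≤ (1 + y ^ k) * Real.exp (-c * y) := mul_le_mul_of_nonneg_right (h1.trans h2) (Real.exp_pos _).le
    _ = Real.exp (-c * y) + y ^ k * Real.exp (-c * y) := by ring
    _ ≤ _ := by linarith

lemma Calpha_scale (k q : ℕ) (hq : 1 ≤ q) (c : ℝ) (hc : 0 < c) (α : Fin m → ℕ)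
    (hα : ∑ i, α i = k) (s : EuclideanSpace ℝ (Fin m)) (ε : ℝ) (hε : 0 < ε) :
    |∏ i, s i ^ α i| * Real.exp (-(c * ‖s‖ ^ q) / ε) ≤ ε ^ ((k : ℝ) / q) *
      ⨆ v : EuclideanSpace ℝ (Fin m), |∏ i, v i ^ α i| * Real.exp (-c * ‖v‖ ^ q) := by
  set δ : ℝ := ε ^ ((1 : ℝ) / q) with hδ
  have hδ0 : 0 < δ := Real.rpow_pos_of_pos hε _
  have hq0 : (q : ℝ) ≠ 0 := by positivity
  have hδq : δ ^ q = ε := by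
    rw [hδ, ← Real.rpow_natCast, ← Real.rpow_mul hε.le, one_div_mul_cancel hq0, Real.rpow_one]
  have hδk : δ ^ k = ε ^ ((k : ℝ) / q) := by
    rw [hδ, ← Real.rpow_natCast, ← Real.rpow_mul hε.le]
    congr 1; ring
  have h := le_ciSup (Calpha_bdd k q hq c hc α hα) (δ⁻¹ • s)
  have hn : -c * ‖δ⁻¹ • s‖ ^ q = -(c * ‖s‖ ^ q) / ε := by
    rw [norm_smul, mul_pow, norm_inv, Real.norm_eq_abs, abs_of_pos hδ0, inv_pow, hδq]
    field_simp
  have hp : |∏ i, (δ⁻¹ • s) i ^ α i| = (δ ^ k)⁻¹ * |∏ i, s i ^ α i| := by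
    have : ∏ i, (δ⁻¹ • s) i ^ α i = (δ ^ k)⁻¹ * ∏ i, s i ^ α i := by
      simp only [PiLp.smul_apply, smul_eq_mul, mul_pow, Finset.prod_mul_distrib]
      rw [Finset.prod_pow_eq_pow_sum, hα, inv_pow]
    rw [this, abs_mul, abs_of_pos (by positivity)]
  simp only at h
  rw [hn, hp] at h
  rw [← hδk]
  calc _ = δ ^ k * ((δ ^ k)⁻¹ * |∏ i, s i ^ α i| * Real.exp (-(c * ‖s‖ ^ q) / ε)) := by
        field_simp
    _ ≤ _ := by gcongr

/-- joint smoothness of iterated partial derivatives -/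
lemma pd_joint {d₁ : ℕ} {U : Set (ℝ × (EuclideanSpace ℝ (Fin d₁) × EuclideanSpace ℝ (Fin m)))}
    (hU : IsOpen U) (i : Fin m) {n : ℕ}
    {f : ℝ → EuclideanSpace ℝ (Fin d₁) → EuclideanSpace ℝ (Fin m) → ℂ}
    (hf : ContDiffOn ℝ ((n + 1 : ℕ) : WithTop ℕ∞) (fun w : ℝ × (EuclideanSpace ℝ (Fin d₁) × EuclideanSpace ℝ (Fin m)) =>
      f w.1 w.2.1 w.2.2) U) :
    ContDiffOn ℝ (n : WithTop ℕ∞) (fun w : ℝ × (EuclideanSpace ℝ (Fin d₁) × EuclideanSpace ℝ (Fin m)) =>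
      pd i (f w.1 w.2.1) w.2.2) U := by
  have h := hf.fderiv_of_isOpen hU (m := (n : WithTop ℕ∞)) (by norm_cast)
  have h2 := h.clm_apply (contDiffOn_const (c := ((0, (0, EuclideanSpace.single i 1)) :
    ℝ × (EuclideanSpace ℝ (Fin d₁) × EuclideanSpace ℝ (Fin m)))))
  refine h2.congr ?_
  rintro ⟨t, r, s⟩ hw
  have hd : DifferentiableAt ℝ (fun w : ℝ × (EuclideanSpace ℝ (Fin d₁) × EuclideanSpace ℝ (Fin m)) =>
      f w.1 w.2.1 w.2.2) (t, r, s) :=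
    (hf.contDiffAt (hU.mem_nhds hw)).differentiableAt (by norm_cast)
  have hl : HasFDerivAt (fun s' : EuclideanSpace ℝ (Fin m) => (t, (r, s')))
      ((0 : EuclideanSpace ℝ (Fin m) →L[ℝ] ℝ).prod
        ((0 : EuclideanSpace ℝ (Fin m) →L[ℝ] EuclideanSpace ℝ (Fin d₁)).prod
          (ContinuousLinearMap.id ℝ _))) s :=
    (hasFDerivAt_const t s).prodMk ((hasFDerivAt_const r s).prodMk (hasFDerivAt_id s))
  have hc := HasFDerivAt.comp s hd.hasFDerivAt hl
  have : fderiv ℝ (f t r) s = _ := hc.fderiv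
  simp only [pd, this]
  simp

lemma mpd_joint {d₁ : ℕ} {U : Set (ℝ × (EuclideanSpace ℝ (Fin d₁) × EuclideanSpace ℝ (Fin m)))}
    (hU : IsOpen U) (α : Fin m → ℕ) {n k : ℕ} (hk : n + ∑ i, α i ≤ k)
    {f : ℝ → EuclideanSpace ℝ (Fin d₁) → EuclideanSpace ℝ (Fin m) → ℂ}
    (hf : ContDiffOn ℝ (k : WithTop ℕ∞) (fun w : ℝ × (EuclideanSpace ℝ (Fin d₁) × EuclideanSpace ℝ (Fin m)) =>
      f w.1 w.2.1 w.2.2) U) :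
    ContDiffOn ℝ (n : WithTop ℕ∞) (fun w : ℝ × (EuclideanSpace ℝ (Fin d₁) × EuclideanSpace ℝ (Fin m)) =>
      mpd α (f w.1 w.2.1) w.2.2) U := by
  have hit : ∀ (i : Fin m) (a n : ℕ) (f : ℝ → EuclideanSpace ℝ (Fin d₁) → EuclideanSpace ℝ (Fin m) → ℂ),
      ContDiffOn ℝ ((n + a : ℕ) : WithTop ℕ∞) (fun w : ℝ × (EuclideanSpace ℝ (Fin d₁) × EuclideanSpace ℝ (Fin m)) =>
        f w.1 w.2.1 w.2.2) U →
      ContDiffOn ℝ (n : WithTop ℕ∞) (fun w : ℝ × (EuclideanSpace ℝ (Fin d₁) × EuclideanSpace ℝ (Fin m)) =>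
        ((pd i)^[a] (f w.1 w.2.1)) w.2.2) U := by
    intro i a
    induction a with
    | zero => intro n f hf; simpa using hf
    | succ a ih =>
      intro n f hf
      exact ih n (fun t r => pd i (f t r)) (pd_joint hU i hf)
  have hl : ∀ (l : List (Fin m)) (n : ℕ),
      ContDiffOn ℝ ((n + (l.map α).sum : ℕ) : WithTop ℕ∞) (fun w : ℝ × (EuclideanSpace ℝ (Fin d₁) × EuclideanSpace ℝ (Fin m)) =>
        f w.1 w.2.1 w.2.2) U →
      ContDiffOn ℝ (n : WithTop ℕ∞) (fun w : ℝ × (EuclideanSpace ℝ (Fin d₁) × EuclideanSpace ℝ (Fin m)) =>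
        (fpd α l (f w.1 w.2.1)) w.2.2) U := by
    intro l
    induction l with
    | nil => intro n hf; simpa [fpd] using hf
    | cons j l ih =>
      intro n hf
      refine hit j (α j) n (fun t r => fpd α l (f t r)) (ih _ ?_)
      simpa [add_assoc] using hf
  refine hl (List.finRange m) n ?_
  rw [sum_finRange]
  exact hf.of_le (by exact_mod_cast hk)

end helpers

/-- **Maslov-type estimate near the reference manifold `{s = 0}`.**
If `χ = Im φ ≥ c|s|^q` on `[0,T] × Ā` and `f` is `C^k` in a neighborhood of `[0,T] × Ā`
(`Ā` bounded, with `s`-sections star-shaped about `0` and meeting `{s = 0}`), then the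
`k`-th Taylor remainder of `f` in `s` at `s = 0`, multiplied by `e^{iφ/ε}`, is bounded by
`ε^{k/q} ∑_{|α| = k} (sup |∂_s^α f|) C_α`, with `C_α = sup_v |v^α| e^{-c|v|^q}`. -/
theorem stmt_2 (d₁ d₂ : ℕ) (T : ℝ) (hT : 0 < T) (k q : ℕ) (hq : 1 ≤ q) (c : ℝ) (hc : 0 < c)
    (A : Set (EuclideanSpace ℝ (Fin d₁) × EuclideanSpace ℝ (Fin d₂)))
    (hAopen : IsOpen A) (hAbdd : Bornology.IsBounded A)
    (hA0 : (A ∩ {p | p.2 = 0}).Nonempty)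
    (hstar : ∀ p ∈ closure A, ∀ τ ∈ Set.Icc (0:ℝ) 1, (p.1, τ • p.2) ∈ closure A)
    (φ f : ℝ → EuclideanSpace ℝ (Fin d₁) → EuclideanSpace ℝ (Fin d₂) → ℂ)
    (hφcont : ContinuousOn (fun w : ℝ × (EuclideanSpace ℝ (Fin d₁) × EuclideanSpace ℝ (Fin d₂)) =>
      φ w.1 w.2.1 w.2.2) (Set.Icc 0 T ×ˢ closure A))
    (hχ : ∀ t ∈ Set.Icc (0:ℝ) T, ∀ p ∈ closure A, c * ‖p.2‖ ^ q ≤ (φ t p.1 p.2).im)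
    (U : Set (ℝ × (EuclideanSpace ℝ (Fin d₁) × EuclideanSpace ℝ (Fin d₂))))
    (hUopen : IsOpen U) (hUsub : Set.Icc 0 T ×ˢ closure A ⊆ U)
    (hf : ContDiffOn ℝ k (fun w : ℝ × (EuclideanSpace ℝ (Fin d₁) × EuclideanSpace ℝ (Fin d₂)) =>
      f w.1 w.2.1 w.2.2) U) :
    ∀ t ∈ Set.Icc (0:ℝ) T, ∀ p ∈ closure A, ∀ ε : ℝ, 0 < ε →
      ‖(f t p.1 p.2 -
          ∑ α ∈ Finset.univ.filter (fun α : Fin d₂ → Fin (k + 1) => ∑ i, (α i : ℕ) < k),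
            (mpd (fun i => (α i : ℕ)) (f t p.1) 0 / (∏ i, ((α i : ℕ).factorial : ℂ))) *
              ∏ i, (p.2 i : ℂ) ^ (α i : ℕ)) *
        Complex.exp (Complex.I * φ t p.1 p.2 / (ε : ℂ))‖ ≤
      ε ^ ((k : ℝ) / q) *
        ∑ α ∈ Finset.univ.filter (fun α : Fin d₂ → Fin (k + 1) => ∑ i, (α i : ℕ) = k),
          sSup ((fun w : ℝ × (EuclideanSpace ℝ (Fin d₁) × EuclideanSpace ℝ (Fin d₂)) =>
              ‖mpd (fun i => (α i : ℕ)) (f w.1 w.2.1) w.2.2‖) '' (Set.Icc 0 T ×ˢ closure A)) *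
            ⨆ v : EuclideanSpace ℝ (Fin d₂), |∏ i, v i ^ (α i : ℕ)| * Real.exp (-c * ‖v‖ ^ q) := by
  intro t ht p hp ε hε
  have hK : IsCompact (Set.Icc (0:ℝ) T ×ˢ closure A) :=
    isCompact_Icc.prod hAbdd.isCompact_closure
  set V : Set (EuclideanSpace ℝ (Fin d₂)) := (fun s => (t, (p.1, s))) ⁻¹' U with hVdef
  have hV : IsOpen V := hUopen.preimage (by fun_prop)
  have hg : ContDiffOn ℝ (k : WithTop ℕ∞) (f t p.1) V := by
    have : ContDiff ℝ (k : WithTop ℕ∞) (fun s : EuclideanSpace ℝ (Fin d₂) => (t, (p.1, s))) := by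
      fun_prop
    exact hf.comp this.contDiffOn (fun s hs => hs)
  have hmem : ∀ τ ∈ Set.Icc (0:ℝ) 1,
      ((t, (p.1, τ • p.2)) : ℝ × (EuclideanSpace ℝ (Fin d₁) × EuclideanSpace ℝ (Fin d₂))) ∈
        Set.Icc (0:ℝ) T ×ˢ closure A := fun τ hτ => ⟨ht, hstar p hp τ hτ⟩
  set S : (Fin d₂ → ℕ) → ℝ := fun α =>
    sSup ((fun w : ℝ × (EuclideanSpace ℝ (Fin d₁) × EuclideanSpace ℝ (Fin d₂)) =>
      ‖mpd α (f w.1 w.2.1) w.2.2‖) '' (Set.Icc 0 T ×ˢ closure A)) with hSdef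
  have hS : ∀ α : Fin d₂ → ℕ, ∑ i, α i = k → ∀ τ ∈ Set.Icc (0:ℝ) 1,
      ‖mpd α (f t p.1) (τ • p.2)‖ ≤ S α := by
    intro α hα τ hτ
    have hc := (mpd_joint hUopen α (n := 0) (by omega) hf).continuousOn.norm.mono hUsub
    exact le_csSup (hK.bddAbove_image hc) ⟨_, hmem τ hτ, rfl⟩
  have hS0 : ∀ α : Fin d₂ → ℕ, 0 ≤ S α := by
    intro α
    apply Real.sSup_nonneg
    rintro _ ⟨w, _, rfl⟩
    exact norm_nonneg _
  have hT := taylor_mv hV hg p.2 (fun τ hτ => hUsub (hmem τ hτ)) S hS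
  rw [sum_fin_lt k (fun α : Fin d₂ → ℕ =>
    (mpd α (f t p.1) 0 / (∏ i, ((α i).factorial : ℂ))) * ∏ i, (p.2 i : ℂ) ^ (α i))]
  rw [sum_fin_eq k k le_rfl (fun α : Fin d₂ → ℕ => S α *
    ⨆ v : EuclideanSpace ℝ (Fin d₂), |∏ i, v i ^ α i| * Real.exp (-c * ‖v‖ ^ q))]
  have hexp : ‖Complex.exp (Complex.I * φ t p.1 p.2 / (ε : ℂ))‖ ≤
      Real.exp (-(c * ‖p.2‖ ^ q) / ε) := by
    rw [Complex.norm_exp, Complex.div_ofReal_re]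
    apply Real.exp_le_exp.2
    have := hχ t ht p hp
    simp only [Complex.mul_re, Complex.I_re, Complex.I_im, zero_mul, one_mul, zero_sub]
    gcongr
  rw [norm_mul]
  refine (mul_le_mul hT hexp (norm_nonneg _) ((norm_nonneg _).trans hT)).trans ?_
  rw [Finset.sum_mul, Finset.mul_sum]
  apply Finset.sum_le_sum
  intro α hα
  simp only [Finset.mem_piAntidiag] at hα
  have h := mul_le_mul_of_nonneg_left
    (Calpha_scale k q hq c hc α hα.1 p.2 ε hε) (hS0 α)
  calc _ = S α * (|∏ i, p.2 i ^ α i| * Real.exp (-(c * ‖p.2‖ ^ q) / ε)) := by ring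
    _ ≤ _ := h
    _ = _ := by ring
end

section
/- Let A, π_l : K × (ℝ^d \ {0}) → End(ℂ^N) and λ_l : K × (ℝ^d \ {0}) → ℝ be smooth, K ⊆ ℝ^{1+d}, satisfying A = ∑_l λ_l π_l and A π_l = λ_l π_l pointwise. Then for every integer n ≥ 0, every compact K₀ ⊆ K and compact Ξ ⊂ ℝ^d \ {0} there is a constant C such that for all (t,x) ∈ K₀, ξ ∈ Ξ, |η| ≤ 1: ‖Ã⁽ⁿ⁾(t,x,ξ+iη) − ∑_l λ̃_l⁽ⁿ⁾(t,x,ξ+iη) π̃_l⁽ⁿ⁾(t,x,ξ+iη)‖ ≤ C|η|^{n+1} and ‖Ã⁽ⁿ⁾(t,x,ξ+iη) π̃_l⁽ⁿ⁾(t,x,ξ+iη) − λ̃_l⁽ⁿ⁾(t,x,ξ+iη) π̃_l⁽ⁿ⁾(t,x,ξ+iη)‖ ≤ C|η|^{n+1} for every l. -/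
attribute [local instance] Matrix.normedAddCommGroup Matrix.normedSpace

/-- The `n`-th order complex extension
`f̃⁽ⁿ⁾(ξ+iη) = ∑_{|α| ≤ n} (i^{|α|}/α!) ∂_ξ^α f(ξ) η^α`. -/
noncomputable def cext {E : Type*} [NormedAddCommGroup E] [NormedSpace ℂ E] {m : ℕ}
    (n : ℕ) (f : EuclideanSpace ℝ (Fin m) → E) (ξ η : EuclideanSpace ℝ (Fin m)) : E :=
  ∑ α ∈ Finset.univ.filter (fun α : Fin m → Fin (n + 1) => ∑ i, (α i : ℕ) ≤ n),
    ((Complex.I ^ (∑ i, (α i : ℕ)) * ∏ i, (η i : ℂ) ^ (α i : ℕ)) /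
        (∏ i, ((α i : ℕ).factorial : ℂ))) • mpd (fun i => (α i : ℕ)) f ξ

open Set Filter Topology

section leib
variable {E F G : Type*} [NormedAddCommGroup E] [NormedSpace ℝ E]
  [NormedAddCommGroup F] [NormedSpace ℝ F] [NormedAddCommGroup G] [NormedSpace ℝ G] {m : ℕ}
  {U : Set (EuclideanSpace ℝ (Fin m))}

lemma pd_smooth (hU : IsOpen U) (i : Fin m) {f : EuclideanSpace ℝ (Fin m) → E}
    (hf : ContDiffOn ℝ (⊤ : ℕ∞) f U) : ContDiffOn ℝ (⊤ : ℕ∞) (pd i f) U := by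
  have h := hf.fderiv_of_isOpen (m := ((⊤ : ℕ∞) : WithTop ℕ∞)) hU (by simp)
  exact h.clm_apply contDiffOn_const

lemma pdk_smooth (hU : IsOpen U) (i : Fin m) (k : ℕ) {f : EuclideanSpace ℝ (Fin m) → E}
    (hf : ContDiffOn ℝ (⊤ : ℕ∞) f U) : ContDiffOn ℝ (⊤ : ℕ∞) ((pd i)^[k] f) U := by
  induction k with
  | zero => exact hf
  | succ k ih => rw [Function.iterate_succ_apply']; exact pd_smooth hU i ih

lemma pd_congr_s7 (hU : IsOpen U) (i : Fin m) {f g : EuclideanSpace ℝ (Fin m) → E}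
    (h : EqOn f g U) : EqOn (pd i f) (pd i g) U := by
  intro x hx
  have : f =ᶠ[𝓝 x] g := by
    filter_upwards [hU.mem_nhds hx] with y hy using h hy
  simp only [pd, this.fderiv_eq]

lemma pdk_congr (hU : IsOpen U) (i : Fin m) (k : ℕ) {f g : EuclideanSpace ℝ (Fin m) → E}
    (h : EqOn f g U) : EqOn ((pd i)^[k] f) ((pd i)^[k] g) U := by
  induction k with
  | zero => exact h
  | succ k ih =>
    rw [Function.iterate_succ_apply', Function.iterate_succ_apply']; exact pd_congr_s7 hU i ih

lemma smooth_diffAt (hU : IsOpen U) {f : EuclideanSpace ℝ (Fin m) → E}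
    (hf : ContDiffOn ℝ (⊤ : ℕ∞) f U) {x} (hx : x ∈ U) : DifferentiableAt ℝ f x :=
  (hf.contDiffAt (hU.mem_nhds hx)).differentiableAt (by simp)

lemma pd_sum (hU : IsOpen U) (i : Fin m) {ι : Type*} (S : Finset ι) (c : ι → ℝ)
    {f : ι → EuclideanSpace ℝ (Fin m) → E}
    (hf : ∀ s ∈ S, ContDiffOn ℝ (⊤ : ℕ∞) (f s) U) :
    EqOn (pd i (fun x => ∑ s ∈ S, c s • f s x)) (fun x => ∑ s ∈ S, c s • pd i (f s) x) U := by
  intro x hx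
  have h : HasFDerivAt (fun x => ∑ s ∈ S, c s • f s x) (∑ s ∈ S, c s • fderiv ℝ (f s) x) x := by
    refine HasFDerivAt.fun_sum fun s hs => ?_
    exact (smooth_diffAt hU (hf s hs) hx).hasFDerivAt.fun_const_smul (c s)
  simp only [pd, h.fderiv, _root_.sum_apply, _root_.smul_apply]

lemma pdk_sum (hU : IsOpen U) (i : Fin m) (k : ℕ) {ι : Type*} (S : Finset ι) (c : ι → ℝ)
    {f : ι → EuclideanSpace ℝ (Fin m) → E}
    (hf : ∀ s ∈ S, ContDiffOn ℝ (⊤ : ℕ∞) (f s) U) :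
    EqOn ((pd i)^[k] (fun x => ∑ s ∈ S, c s • f s x))
      (fun x => ∑ s ∈ S, c s • (pd i)^[k] (f s) x) U := by
  induction k with
  | zero => intro x _; rfl
  | succ k ih =>
    simp only [Function.iterate_succ_apply']
    refine (pd_congr_s7 hU i ih).trans ?_
    exact pd_sum hU i S c (fun s hs => pdk_smooth hU i k (hf s hs))

lemma bil_smooth (B : E →L[ℝ] F →L[ℝ] G)
    {f : EuclideanSpace ℝ (Fin m) → E} {g : EuclideanSpace ℝ (Fin m) → F}
    (hf : ContDiffOn ℝ (⊤ : ℕ∞) f U) (hg : ContDiffOn ℝ (⊤ : ℕ∞) g U) :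
    ContDiffOn ℝ (⊤ : ℕ∞) (fun x => B (f x) (g x)) U :=
  (B.contDiff.comp_contDiffOn hf).clm_apply hg

lemma pd_bil (hU : IsOpen U) (i : Fin m) (B : E →L[ℝ] F →L[ℝ] G)
    {f : EuclideanSpace ℝ (Fin m) → E} {g : EuclideanSpace ℝ (Fin m) → F}
    (hf : ContDiffOn ℝ (⊤ : ℕ∞) f U) (hg : ContDiffOn ℝ (⊤ : ℕ∞) g U) :
    EqOn (pd i (fun x => B (f x) (g x)))
      (fun x => B (f x) (pd i g x) + B (pd i f x) (g x)) U := by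
  intro x hx
  simp only [pd, B.fderiv_of_bilinear (smooth_diffAt hU hf hx) (smooth_diffAt hU hg hx)]
  simp

lemma pdk_bil (hU : IsOpen U) (i : Fin m) (k : ℕ) (B : E →L[ℝ] F →L[ℝ] G)
    {f : EuclideanSpace ℝ (Fin m) → E} {g : EuclideanSpace ℝ (Fin m) → F}
    (hf : ContDiffOn ℝ (⊤ : ℕ∞) f U) (hg : ContDiffOn ℝ (⊤ : ℕ∞) g U) :
    EqOn ((pd i)^[k] (fun x => B (f x) (g x)))
      (fun x => ∑ s ∈ Finset.HasAntidiagonal.antidiagonal k, ((k.choose s.1 : ℕ) : ℝ) •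
        B ((pd i)^[s.1] f x) ((pd i)^[s.2] g x)) U := by
  induction k with
  | zero => intro x _; simp
  | succ k ih =>
    intro x hx
    simp only [Function.iterate_succ_apply']
    rw [pd_congr_s7 hU i ih hx, pd_sum hU i _ _ (fun s _ => bil_smooth B
      (pdk_smooth hU i s.1 hf) (pdk_smooth hU i s.2 hg)) hx]
    simp only [Nat.cast_smul_eq_nsmul]
    rw [Finset.sum_antidiagonal_choose_succ_nsmul
      (fun a b => B ((pd i)^[a] f x) ((pd i)^[b] g x)) k]
    rw [← Finset.sum_add_distrib]
    refine Finset.sum_congr rfl fun s hs => ?_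
    rw [pd_bil hU i B (pdk_smooth hU i s.1 hf) (pdk_smooth hU i s.2 hg) hx]
    simp only [Function.iterate_succ_apply', smul_add]
    rw [Nat.choose_symm_of_eq_add (Finset.HasAntidiagonal.mem_antidiagonal.1 hs).symm]

/-- Iterated partial derivative along a list of directions. -/
noncomputable def mpdE {k : ℕ} (e : Fin k → Fin m) (α : Fin k → ℕ)
    (f : EuclideanSpace ℝ (Fin m) → E) : EuclideanSpace ℝ (Fin m) → E :=
  (List.finRange k).foldr (fun i g => (pd (e i))^[α i] g) f

lemma mpdE_succ {k : ℕ} (e : Fin (k + 1) → Fin m) (α : Fin (k + 1) → ℕ)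
    (f : EuclideanSpace ℝ (Fin m) → E) :
    mpdE e α f = (pd (e 0))^[α 0] (mpdE (fun j => e j.succ) (fun j => α j.succ) f) := by
  simp only [mpdE, List.finRange_succ, List.foldr_cons, List.foldr_map]

lemma mpdE_smooth (hU : IsOpen U) {k : ℕ} (e : Fin k → Fin m) (α : Fin k → ℕ)
    {f : EuclideanSpace ℝ (Fin m) → E}
    (hf : ContDiffOn ℝ (⊤ : ℕ∞) f U) : ContDiffOn ℝ (⊤ : ℕ∞) (mpdE e α f) U := by
  induction k with
  | zero => exact hf
  | succ k ih => rw [mpdE_succ]; exact pdk_smooth hU _ _ (ih _ _)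

lemma mpdE_congr (hU : IsOpen U) {k : ℕ} (e : Fin k → Fin m) (α : Fin k → ℕ)
    {f g : EuclideanSpace ℝ (Fin m) → E}
    (h : EqOn f g U) : EqOn (mpdE e α f) (mpdE e α g) U := by
  induction k with
  | zero => exact h
  | succ k ih => rw [mpdE_succ, mpdE_succ]; exact pdk_congr hU _ _ (ih _ _)

lemma mpdE_sum (hU : IsOpen U) {k : ℕ} (e : Fin k → Fin m) (α : Fin k → ℕ)
    {ι : Type*} (S : Finset ι) (c : ι → ℝ)
    {f : ι → EuclideanSpace ℝ (Fin m) → E}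
    (hf : ∀ s ∈ S, ContDiffOn ℝ (⊤ : ℕ∞) (f s) U) :
    EqOn (mpdE e α (fun x => ∑ s ∈ S, c s • f s x))
      (fun x => ∑ s ∈ S, c s • mpdE e α (f s) x) U := by
  induction k with
  | zero => intro x _; rfl
  | succ k ih =>
    simp only [mpdE_succ]
    refine (pdk_congr hU _ _ (ih _ _)).trans ?_
    exact pdk_sum hU _ _ S c (fun s hs => mpdE_smooth hU _ _ (hf s hs))

lemma sum_piFinset_succ {M ι : Type*} [AddCommMonoid M] [DecidableEq ι] {k : ℕ} (t : Fin (k + 1) → Finset ι)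
    (φ : (Fin (k + 1) → ι) → M) :
    ∑ s ∈ Fintype.piFinset t, φ s =
      ∑ s ∈ Fintype.piFinset (fun j => t j.succ), ∑ a ∈ t 0, φ (Fin.cons a s) := by
  rw [← Finset.sum_product']
  symm
  refine Finset.sum_nbij' (fun p => Fin.cons p.2 p.1) (fun s => (fun j => s j.succ, s 0)) ?_ ?_ ?_ ?_ ?_
  · rintro ⟨s, a⟩ h
    simp only [Finset.mem_product, Fintype.mem_piFinset] at h ⊢
    intro j
    refine Fin.cases ?_ (fun j => ?_) j
    · simpa using h.2
    · simpa using h.1 j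
  · intro s h
    simp only [Finset.mem_product, Fintype.mem_piFinset] at h ⊢
    exact ⟨fun j => h _, h _⟩
  · rintro ⟨s, a⟩ h
    simp
  · intro s h
    exact Fin.cons_self_tail s
  · intro p h; rfl

lemma mpdE_bil (hU : IsOpen U) {k : ℕ} (e : Fin k → Fin m) (α : Fin k → ℕ)
    (B : E →L[ℝ] F →L[ℝ] G)
    {f : EuclideanSpace ℝ (Fin m) → E} {g : EuclideanSpace ℝ (Fin m) → F}
    (hf : ContDiffOn ℝ (⊤ : ℕ∞) f U) (hg : ContDiffOn ℝ (⊤ : ℕ∞) g U) :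
    EqOn (mpdE e α (fun x => B (f x) (g x)))
      (fun x => ∑ s ∈ Fintype.piFinset (fun j => Finset.HasAntidiagonal.antidiagonal (α j)),
        (∏ j, (((α j).choose (s j).1 : ℕ) : ℝ)) •
        B (mpdE e (fun j => (s j).1) f x) (mpdE e (fun j => (s j).2) g x)) U := by
  induction k with
  | zero => intro x _; simp [mpdE]
  | succ k ih =>
    intro x hx
    rw [mpdE_succ, pdk_congr hU _ _ (ih _ _) hx, pdk_sum hU _ _ _ _
      (fun s _ => bil_smooth B (mpdE_smooth hU _ _ hf) (mpdE_smooth hU _ _ hg)) hx]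
    simp only
    rw [sum_piFinset_succ]
    refine Finset.sum_congr rfl fun s hs => ?_
    rw [pdk_bil hU _ _ B (mpdE_smooth hU _ _ hf) (mpdE_smooth hU _ _ hg) hx, Finset.smul_sum]
    refine Finset.sum_congr rfl fun a ha => ?_
    simp only [mpdE_succ, Fin.prod_univ_succ, Fin.cons_zero, Fin.cons_succ, smul_smul]
    rw [mul_comm]

/-- Smooth families are stable under partial derivatives in the second variable. -/
lemma pd_family {P : Type*} [NormedAddCommGroup P] [NormedSpace ℝ P] {K : Set P}
    (hU : IsOpen U) (i : Fin m) {f : P → EuclideanSpace ℝ (Fin m) → E}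
    (hf : ContDiffOn ℝ (⊤ : ℕ∞) (fun w : P × EuclideanSpace ℝ (Fin m) => f w.1 w.2) (K ×ˢ U)) :
    ContDiffOn ℝ (⊤ : ℕ∞)
      (fun w : P × EuclideanSpace ℝ (Fin m) => pd i (f w.1) w.2) (K ×ˢ U) := by
  rw [contDiffOn_infty]
  intro n w hw
  have h1 : ContDiffWithinAt ℝ ((n : WithTop ℕ∞) + 1)
      (fun w : P × EuclideanSpace ℝ (Fin m) => f w.1 w.2) (K ×ˢ U) w :=
    (contDiffOn_infty.1 hf (n + 1)) w hw
  obtain ⟨u, hu, -, -, f', hf', hsm⟩ :=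
    (contDiffWithinAt_succ_iff_hasFDerivWithinAt' (by simp)).1 h1
  rw [insert_eq_of_mem hw] at hu
  have key : ∀ z ∈ u, z ∈ K ×ˢ U → pd i (f z.1) z.2 = f' z (0, EuclideanSpace.single i 1) := by
    rintro ⟨p, ξ⟩ hz ⟨hp, hξ⟩
    have h2 := hf' _ hz
    have h3 : HasFDerivWithinAt (fun ζ : EuclideanSpace ℝ (Fin m) => (p, ζ))
        (ContinuousLinearMap.inr ℝ P (EuclideanSpace ℝ (Fin m))) U ξ :=
      (hasFDerivAt_prodMk_right p ξ).hasFDerivWithinAt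
    have h4 := (HasFDerivWithinAt.comp (t := K ×ˢ U) ξ h2 h3 (fun ζ hζ => ⟨hp, hζ⟩)).hasFDerivAt
      (hU.mem_nhds hξ)
    have h5 : fderiv ℝ (f p) ξ = _ := h4.fderiv
    simp only [pd, h5]
    simp
  refine (hsm.clm_apply (contDiffWithinAt_const (c := ((0 : P), EuclideanSpace.single i (1 : ℝ))))).congr_of_eventuallyEq ?_ ?_
  · filter_upwards [hu, self_mem_nhdsWithin] with z hz hz' using key z hz hz'
  · exact key w (mem_of_mem_nhdsWithin hw hu) hw

lemma pdk_family {P : Type*} [NormedAddCommGroup P] [NormedSpace ℝ P] {K : Set P}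
    (hU : IsOpen U) (i : Fin m) (k : ℕ) {f : P → EuclideanSpace ℝ (Fin m) → E}
    (hf : ContDiffOn ℝ (⊤ : ℕ∞) (fun w : P × EuclideanSpace ℝ (Fin m) => f w.1 w.2) (K ×ˢ U)) :
    ContDiffOn ℝ (⊤ : ℕ∞)
      (fun w : P × EuclideanSpace ℝ (Fin m) => (pd i)^[k] (f w.1) w.2) (K ×ˢ U) := by
  induction k with
  | zero => exact hf
  | succ k ih =>
    simp only [Function.iterate_succ_apply']
    exact pd_family (f := fun p => (pd i)^[k] (f p)) hU i ih

lemma mpdE_family {P : Type*} [NormedAddCommGroup P] [NormedSpace ℝ P] {K : Set P}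
    (hU : IsOpen U) {k : ℕ} (e : Fin k → Fin m) (α : Fin k → ℕ)
    {f : P → EuclideanSpace ℝ (Fin m) → E}
    (hf : ContDiffOn ℝ (⊤ : ℕ∞) (fun w : P × EuclideanSpace ℝ (Fin m) => f w.1 w.2) (K ×ˢ U)) :
    ContDiffOn ℝ (⊤ : ℕ∞)
      (fun w : P × EuclideanSpace ℝ (Fin m) => mpdE e α (f w.1) w.2) (K ×ˢ U) := by
  induction k with
  | zero => exact hf
  | succ k ih =>
    simp only [mpdE_succ]
    exact pdk_family (f := fun p => mpdE (fun j => e j.succ) (fun j => α j.succ) (f p)) hU _ _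
      (ih _ _)

lemma slice_smooth {P : Type*} [NormedAddCommGroup P] [NormedSpace ℝ P] {K : Set P}
    {f : P → EuclideanSpace ℝ (Fin m) → E}
    (hf : ContDiffOn ℝ (⊤ : ℕ∞) (fun w : P × EuclideanSpace ℝ (Fin m) => f w.1 w.2) (K ×ˢ U))
    {p : P} (hp : p ∈ K) : ContDiffOn ℝ (⊤ : ℕ∞) (f p) U :=
  hf.comp (contDiff_prodMk_right p).contDiffOn (fun _ hζ => ⟨hp, hζ⟩)

/-- The multi-indices of length at most `n`. -/
def simplexN (m n : ℕ) : Finset (Fin m → ℕ) :=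
  (Fintype.piFinset (fun _ => Finset.range (n + 1))).filter (fun α => ∑ i, α i ≤ n)

lemma mem_simplexN {m n : ℕ} {α : Fin m → ℕ} : α ∈ simplexN m n ↔ ∑ i, α i ≤ n := by
  simp only [simplexN, Finset.mem_filter, Fintype.mem_piFinset, Finset.mem_range,
    and_iff_right_iff_imp]
  intro h i
  have := Finset.single_le_sum (f := α) (fun i _ => Nat.zero_le _) (Finset.mem_univ i)
  omega

lemma family_bound {P : Type*} [NormedAddCommGroup P] [NormedSpace ℝ P] {K : Set P}
    (hU : IsOpen U) {f : P → EuclideanSpace ℝ (Fin m) → E}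
    (hf : ContDiffOn ℝ (⊤ : ℕ∞) (fun w : P × EuclideanSpace ℝ (Fin m) => f w.1 w.2) (K ×ˢ U))
    (n : ℕ) {K₀ : Set P} (hK₀ : IsCompact K₀) (hK : K₀ ⊆ K)
    {Ξ : Set (EuclideanSpace ℝ (Fin m))} (hΞ : IsCompact Ξ) (hΞU : Ξ ⊆ U) :
    ∃ M : ℝ, 0 ≤ M ∧ ∀ p ∈ K₀, ∀ ξ ∈ Ξ, ∀ α ∈ simplexN m n, ‖mpd α (f p) ξ‖ ≤ M := by
  have h : ∀ α : Fin m → ℕ, ∃ C : ℝ, ∀ w ∈ K₀ ×ˢ Ξ, ‖mpd α (f w.1) w.2‖ ≤ C := fun α =>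
    (hK₀.prod hΞ).exists_bound_of_continuousOn
      ((mpdE_family hU id α hf).continuousOn.mono (prod_mono hK hΞU))
  choose C hC using h
  refine ⟨∑ α ∈ simplexN m n, |C α|, Finset.sum_nonneg fun _ _ => abs_nonneg _, ?_⟩
  intro p hp ξ hξ α hα
  calc _ ≤ C α := hC α (p, ξ) ⟨hp, hξ⟩
    _ ≤ |C α| := le_abs_self _
    _ ≤ _ := Finset.single_le_sum (f := fun α => |C α|) (fun _ _ => abs_nonneg _) hα

end leib

section cextsec
variable {E F G : Type*} [NormedAddCommGroup E] [NormedSpace ℂ E]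
  [NormedAddCommGroup F] [NormedSpace ℂ F] [NormedAddCommGroup G] [NormedSpace ℂ G] {m : ℕ}
  {U : Set (EuclideanSpace ℝ (Fin m))}

/-- The coefficient of `∂^α f` in the extension. -/
noncomputable def ccoef (η : EuclideanSpace ℝ (Fin m)) (α : Fin m → ℕ) : ℂ :=
  (Complex.I ^ (∑ i, α i) * ∏ i, (η i : ℂ) ^ α i) / (∏ i, ((α i).factorial : ℂ))

lemma cext_eq (n : ℕ) (f : EuclideanSpace ℝ (Fin m) → E) (ξ η : EuclideanSpace ℝ (Fin m)) :
    cext n f ξ η = ∑ α ∈ simplexN m n, ccoef η α • mpd α f ξ := by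
  unfold cext
  refine Finset.sum_bij (fun α _ => fun i => (α i : ℕ)) ?_ ?_ ?_ ?_
  · intro α hα
    rw [mem_simplexN]
    exact (Finset.mem_filter.1 hα).2
  · intro α _ β _ h
    funext i
    exact Fin.ext (congrFun h i)
  · intro β hβ
    rw [mem_simplexN] at hβ
    have hb : ∀ i, β i < n + 1 := fun i => by
      have := Finset.single_le_sum (f := β) (fun i _ => Nat.zero_le _) (Finset.mem_univ i)
      omega
    exact ⟨fun i => ⟨β i, hb i⟩, by simpa using hβ, rfl⟩
  · intro α _
    rfl

lemma norm_ccoef_le (η : EuclideanSpace ℝ (Fin m)) (α : Fin m → ℕ) :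
    ‖ccoef η α‖ ≤ ‖η‖ ^ (∑ i, α i) := by
  unfold ccoef
  rw [norm_div, norm_mul, norm_pow, Complex.norm_I, one_pow, one_mul, norm_prod, norm_prod]
  have h1 : ∏ i, ‖(η i : ℂ) ^ α i‖ ≤ ‖η‖ ^ (∑ i, α i) := by
    rw [← Finset.prod_pow_eq_pow_sum]
    refine Finset.prod_le_prod (fun _ _ => norm_nonneg _) fun i _ => ?_
    rw [norm_pow, Complex.norm_real]
    gcongr
    exact PiLp.norm_apply_le η i
  have h2 : (1 : ℝ) ≤ ∏ i, ‖((α i).factorial : ℂ)‖ := by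
    rw [← Finset.prod_const_one (s := (Finset.univ : Finset (Fin m)))]
    refine Finset.prod_le_prod (fun _ _ => zero_le_one) fun i _ => ?_
    rw [Complex.norm_natCast]
    exact_mod_cast Nat.succ_le_of_lt (Nat.factorial_pos _)
  calc _ ≤ ∏ i, ‖(η i : ℂ) ^ α i‖ :=
        div_le_self (Finset.prod_nonneg fun _ _ => norm_nonneg _) h2
    _ ≤ _ := h1

lemma ccoef_add (η : EuclideanSpace ℝ (Fin m)) (β γ : Fin m → ℕ) :
    ccoef η (fun i => β i + γ i) * ∏ i, ((((β i + γ i).choose (β i) : ℕ) : ℝ) : ℂ) =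
      ccoef η β * ccoef η γ := by
  have h : ∏ i, (((β i + γ i).factorial : ℕ) : ℂ) =
      (∏ i, ((((β i + γ i).choose (β i) : ℕ) : ℝ) : ℂ)) *
      ((∏ i, ((β i).factorial : ℂ)) * ∏ i, ((γ i).factorial : ℂ)) := by
    rw [← Finset.prod_mul_distrib, ← Finset.prod_mul_distrib]
    refine Finset.prod_congr rfl fun i _ => ?_
    have h0 := Nat.choose_mul_factorial_mul_factorial (Nat.le_add_right (β i) (γ i))
    rw [Nat.add_sub_cancel_left] at h0
    rw [← h0]
    push_cast
    ring
  have hc : (∏ i, ((((β i + γ i).choose (β i) : ℕ) : ℝ) : ℂ)) ≠ 0 := by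
    refine Finset.prod_ne_zero_iff.2 fun i _ => ?_
    have := (Nat.choose_pos (Nat.le_add_right (β i) (γ i))).ne'
    exact_mod_cast this
  have hb : (∏ i, ((β i).factorial : ℂ)) ≠ 0 :=
    Finset.prod_ne_zero_iff.2 fun i _ => by exact_mod_cast (Nat.factorial_pos _).ne'
  have hg : (∏ i, ((γ i).factorial : ℂ)) ≠ 0 :=
    Finset.prod_ne_zero_iff.2 fun i _ => by exact_mod_cast (Nat.factorial_pos _).ne'
  unfold ccoef
  rw [h]
  simp only [pow_add, Finset.sum_add_distrib, Finset.prod_mul_distrib]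
  field_simp

lemma cext_congr (hU : IsOpen U) (n : ℕ) {f g : EuclideanSpace ℝ (Fin m) → E} (h : EqOn f g U)
    {ξ : EuclideanSpace ℝ (Fin m)} (hξ : ξ ∈ U) (η) : cext n f ξ η = cext n g ξ η := by
  rw [cext_eq, cext_eq]
  refine Finset.sum_congr rfl fun α _ => ?_
  congr 1
  exact mpdE_congr hU id α h hξ

lemma cext_sum (hU : IsOpen U) (n : ℕ) {ι : Type*} (S : Finset ι)
    {f : ι → EuclideanSpace ℝ (Fin m) → E}
    (hf : ∀ s ∈ S, ContDiffOn ℝ (⊤ : ℕ∞) (f s) U)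
    {ξ : EuclideanSpace ℝ (Fin m)} (hξ : ξ ∈ U) (η) :
    cext n (fun x => ∑ s ∈ S, f s x) ξ η = ∑ s ∈ S, cext n (f s) ξ η := by
  simp only [cext_eq]
  rw [Finset.sum_comm]
  refine Finset.sum_congr rfl fun α _ => ?_
  rw [← Finset.smul_sum]
  congr 1
  have := mpdE_sum hU id α S (fun _ => (1 : ℝ)) hf hξ
  simp only [one_smul] at this
  exact this

lemma cext_bil (hU : IsOpen U) (n : ℕ) (B : E →L[ℝ] F →L[ℝ] G)
    {f : EuclideanSpace ℝ (Fin m) → E} {g : EuclideanSpace ℝ (Fin m) → F}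
    (hf : ContDiffOn ℝ (⊤ : ℕ∞) f U) (hg : ContDiffOn ℝ (⊤ : ℕ∞) g U)
    {ξ : EuclideanSpace ℝ (Fin m)} (hξ : ξ ∈ U) (η) :
    cext n (fun x => B (f x) (g x)) ξ η =
      ∑ p ∈ (simplexN m n ×ˢ simplexN m n).filter
        (fun p => ∑ i, p.1 i + ∑ i, p.2 i ≤ n),
        (ccoef η p.1 * ccoef η p.2) • B (mpd p.1 f ξ) (mpd p.2 g ξ) := by
  rw [cext_eq]
  have h1 : ∀ α ∈ simplexN m n, ccoef η α • mpd α (fun x => B (f x) (g x)) ξ =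
      ∑ s ∈ Fintype.piFinset (fun j => Finset.HasAntidiagonal.antidiagonal (α j)),
        (ccoef η (fun i => (s i).1) * ccoef η (fun i => (s i).2)) •
          B (mpd (fun i => (s i).1) f ξ) (mpd (fun i => (s i).2) g ξ) := by
    intro α _
    have h2 := mpdE_bil hU id α B hf hg hξ
    change mpd α (fun x => B (f x) (g x)) ξ = _ at h2
    rw [h2, Finset.smul_sum]
    refine Finset.sum_congr rfl fun s hs => ?_
    have hα : α = fun i => (s i).1 + (s i).2 := by
      funext i
      exact (Finset.HasAntidiagonal.mem_antidiagonal.1 (Fintype.mem_piFinset.1 hs i)).symm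
    rw [← ccoef_add, hα, ← Complex.ofReal_prod, mul_smul]
    congr 1
  rw [Finset.sum_congr rfl h1, Finset.sum_sigma']
  refine Finset.sum_bij' (fun q _ => (fun i => (q.2 i).1, fun i => (q.2 i).2))
    (fun p _ => ⟨fun i => p.1 i + p.2 i, fun i => (p.1 i, p.2 i)⟩) ?_ ?_ ?_ ?_ ?_
  · rintro ⟨α, s⟩ h
    simp only [Finset.mem_sigma, mem_simplexN, Fintype.mem_piFinset,
      Finset.HasAntidiagonal.mem_antidiagonal] at h
    simp only [Finset.mem_filter, Finset.mem_product, mem_simplexN]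
    have : ∑ i, (s i).1 + ∑ i, (s i).2 = ∑ i, α i := by
      rw [← Finset.sum_add_distrib]; exact Finset.sum_congr rfl fun i _ => h.2 i
    omega
  · rintro ⟨β, γ⟩ h
    simp only [Finset.mem_filter, Finset.mem_product, mem_simplexN] at h
    simp only [Finset.mem_sigma, mem_simplexN, Fintype.mem_piFinset,
      Finset.HasAntidiagonal.mem_antidiagonal, Finset.sum_add_distrib]
    exact ⟨h.2, fun _ => trivial⟩
  · rintro ⟨α, s⟩ h
    simp only [Finset.mem_sigma, Fintype.mem_piFinset,
      Finset.HasAntidiagonal.mem_antidiagonal] at h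
    have : α = fun i => (s i).1 + (s i).2 := funext fun i => (h.2 i).symm
    subst this
    rfl
  · intro p _; rfl
  · intro q _; rfl

lemma cext_bil_err (hU : IsOpen U) (n : ℕ) (B : E →L[ℝ] F →L[ℝ] G)
    (hB : ∀ (a b : ℂ) x y, B (a • x) (b • y) = (a * b) • B x y)
    {f : EuclideanSpace ℝ (Fin m) → E} {g : EuclideanSpace ℝ (Fin m) → F}
    (hf : ContDiffOn ℝ (⊤ : ℕ∞) f U) (hg : ContDiffOn ℝ (⊤ : ℕ∞) g U)
    {ξ : EuclideanSpace ℝ (Fin m)} (hξ : ξ ∈ U) {η : EuclideanSpace ℝ (Fin m)} (hη : ‖η‖ ≤ 1)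
    {M M' : ℝ} (hM0 : 0 ≤ M) (hM : ∀ α ∈ simplexN m n, ‖mpd α f ξ‖ ≤ M)
    (hM' : ∀ α ∈ simplexN m n, ‖mpd α g ξ‖ ≤ M') :
    ‖B (cext n f ξ η) (cext n g ξ η) - cext n (fun x => B (f x) (g x)) ξ η‖ ≤
      ((simplexN m n ×ˢ simplexN m n).card * (‖B‖ * M * M')) * ‖η‖ ^ (n + 1) := by
  have h1 : B (cext n f ξ η) (cext n g ξ η) = ∑ p ∈ simplexN m n ×ˢ simplexN m n,
      (ccoef η p.1 * ccoef η p.2) • B (mpd p.1 f ξ) (mpd p.2 g ξ) := by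
    rw [cext_eq, cext_eq, map_sum B, _root_.sum_apply, Finset.sum_product]
    refine Finset.sum_congr rfl fun α _ => ?_
    rw [map_sum]
    exact Finset.sum_congr rfl fun β _ => hB _ _ _ _
  rw [h1, cext_bil hU n B hf hg hξ, ← Finset.sum_filter_add_sum_filter_not
    (simplexN m n ×ˢ simplexN m n) (fun p => ∑ i, p.1 i + ∑ i, p.2 i ≤ n), add_sub_cancel_left]
  have h2 : ∀ p ∈ (simplexN m n ×ˢ simplexN m n).filter
      (fun p => ¬ ∑ i, p.1 i + ∑ i, p.2 i ≤ n),
      ‖(ccoef η p.1 * ccoef η p.2) • B (mpd p.1 f ξ) (mpd p.2 g ξ)‖ ≤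
        (‖B‖ * M * M') * ‖η‖ ^ (n + 1) := by
    intro p hp
    rw [Finset.mem_filter, Finset.mem_product] at hp
    have hc : ‖ccoef η p.1 * ccoef η p.2‖ ≤ ‖η‖ ^ (n + 1) := by
      rw [norm_mul]
      calc _ ≤ ‖η‖ ^ (∑ i, p.1 i) * ‖η‖ ^ (∑ i, p.2 i) :=
            mul_le_mul (norm_ccoef_le _ _) (norm_ccoef_le _ _) (norm_nonneg _) (by positivity)
        _ = ‖η‖ ^ (∑ i, p.1 i + ∑ i, p.2 i) := (pow_add _ _ _).symm
        _ ≤ _ := pow_le_pow_of_le_one (norm_nonneg _) hη (by omega)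
    have hb : ‖B (mpd p.1 f ξ) (mpd p.2 g ξ)‖ ≤ ‖B‖ * M * M' := by
      refine (B.le_opNorm₂ _ _).trans ?_
      refine mul_le_mul (mul_le_mul_of_nonneg_left (hM _ hp.1.1) (by positivity))
        (hM' _ hp.1.2) (norm_nonneg _) (by positivity)
    rw [norm_smul, mul_comm]
    exact mul_le_mul hb hc (norm_nonneg _) ((norm_nonneg _).trans hb)
  have h0 : 0 ≤ (‖B‖ * M * M') * ‖η‖ ^ (n + 1) := by
    have hz : (0 : Fin m → ℕ) ∈ simplexN m n := by rw [mem_simplexN]; simp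
    have : 0 ≤ M' := (norm_nonneg _).trans (hM' _ hz)
    positivity
  refine (norm_sum_le _ _).trans ((Finset.sum_le_card_nsmul _ _ _ h2).trans ?_)
  rw [nsmul_eq_mul, mul_assoc (((simplexN m n ×ˢ simplexN m n).card : ℕ) : ℝ)]
  refine mul_le_mul_of_nonneg_right ?_ h0
  exact_mod_cast Finset.card_filter_le _ _

/-- Uniform version of the product estimate for families. -/
lemma family_err {P : Type*} [NormedAddCommGroup P] [NormedSpace ℝ P] {K : Set P}
    (hU : IsOpen U) (n : ℕ) (B : E →L[ℝ] F →L[ℝ] G)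
    (b : E → F → G) (hb : ∀ x y, B x y = b x y)
    (hB : ∀ (u v : ℂ) x y, b (u • x) (v • y) = (u * v) • b x y)
    {f : P → EuclideanSpace ℝ (Fin m) → E} {g : P → EuclideanSpace ℝ (Fin m) → F}
    (hf : ContDiffOn ℝ (⊤ : ℕ∞) (fun w : P × EuclideanSpace ℝ (Fin m) => f w.1 w.2) (K ×ˢ U))
    (hg : ContDiffOn ℝ (⊤ : ℕ∞) (fun w : P × EuclideanSpace ℝ (Fin m) => g w.1 w.2) (K ×ˢ U))
    {K₀ : Set P} (hK₀ : IsCompact K₀) (hK : K₀ ⊆ K)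
    {Ξ : Set (EuclideanSpace ℝ (Fin m))} (hΞ : IsCompact Ξ) (hΞU : Ξ ⊆ U) :
    ∃ C : ℝ, ∀ p ∈ K₀, ∀ ξ ∈ Ξ, ∀ η : EuclideanSpace ℝ (Fin m), ‖η‖ ≤ 1 →
      ‖b (cext n (f p) ξ η) (cext n (g p) ξ η) - cext n (fun x => b (f p x) (g p x)) ξ η‖ ≤
        C * ‖η‖ ^ (n + 1) := by
  simp only [← hb] at hB ⊢
  obtain ⟨M, hM0, hM⟩ := family_bound hU hf n hK₀ hK hΞ hΞU
  obtain ⟨M', -, hM'⟩ := family_bound hU hg n hK₀ hK hΞ hΞU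
  exact ⟨_, fun p hp ξ hξ η hη => cext_bil_err hU n B hB (slice_smooth hf (hK hp))
    (slice_smooth hg (hK hp)) (hΞU hξ) hη hM0 (hM p hp ξ hξ) (hM' p hp ξ hξ)⟩

/-- The decomposition part, for smooth scalar and vector valued functions. -/
lemma cext_decomp (hU : IsOpen U) (n : ℕ) {ι : Type*} [Fintype ι]
    {f : EuclideanSpace ℝ (Fin m) → E}
    {a : ι → EuclideanSpace ℝ (Fin m) → ℂ} {g : ι → EuclideanSpace ℝ (Fin m) → E}
    (ha : ∀ s, ContDiffOn ℝ (⊤ : ℕ∞) (a s) U) (hg : ∀ s, ContDiffOn ℝ (⊤ : ℕ∞) (g s) U)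
    (h : EqOn f (fun x => ∑ s, a s x • g s x) U)
    {ξ : EuclideanSpace ℝ (Fin m)} (hξ : ξ ∈ U) (η) :
    cext n f ξ η = ∑ s, cext n (fun x => a s x • g s x) ξ η := by
  rw [cext_congr hU n h hξ]
  exact cext_sum hU n _ (fun s _ => (ha s).smul (hg s)) hξ η

end cextsec

/-- **Approximate spectral decomposition for the extended symbol.**
If `A = ∑_l λ_l π_l` and `A π_l = λ_l π_l` pointwise on `K × (ℝ^d \ {0})` with all data
smooth, then for every `n`, compact `K₀ ⊆ K` and compact `Ξ ⊂ ℝ^d \ {0}` there is `C` with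
`‖Ã⁽ⁿ⁾ − ∑_l λ̃_l⁽ⁿ⁾ π̃_l⁽ⁿ⁾‖ ≤ C|η|^{n+1}` and
`‖Ã⁽ⁿ⁾ π̃_l⁽ⁿ⁾ − λ̃_l⁽ⁿ⁾ π̃_l⁽ⁿ⁾‖ ≤ C|η|^{n+1}` for `(t,x) ∈ K₀`, `ξ ∈ Ξ`, `|η| ≤ 1`. -/
theorem stmt_7 (d N mm : ℕ) (K : Set (ℝ × EuclideanSpace ℝ (Fin d)))
    (A : (ℝ × EuclideanSpace ℝ (Fin d)) → EuclideanSpace ℝ (Fin d) → Matrix (Fin N) (Fin N) ℂ)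
    (π : Fin mm → (ℝ × EuclideanSpace ℝ (Fin d)) → EuclideanSpace ℝ (Fin d) →
      Matrix (Fin N) (Fin N) ℂ)
    (lam : Fin mm → (ℝ × EuclideanSpace ℝ (Fin d)) → EuclideanSpace ℝ (Fin d) → ℝ)
    (hA : ContDiffOn ℝ (⊤ : ℕ∞)
      (fun w : (ℝ × EuclideanSpace ℝ (Fin d)) × EuclideanSpace ℝ (Fin d) => A w.1 w.2)
      (K ×ˢ {ξ : EuclideanSpace ℝ (Fin d) | ξ ≠ 0}))
    (hπ : ∀ l, ContDiffOn ℝ (⊤ : ℕ∞)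
      (fun w : (ℝ × EuclideanSpace ℝ (Fin d)) × EuclideanSpace ℝ (Fin d) => π l w.1 w.2)
      (K ×ˢ {ξ : EuclideanSpace ℝ (Fin d) | ξ ≠ 0}))
    (hlam : ∀ l, ContDiffOn ℝ (⊤ : ℕ∞)
      (fun w : (ℝ × EuclideanSpace ℝ (Fin d)) × EuclideanSpace ℝ (Fin d) => lam l w.1 w.2)
      (K ×ˢ {ξ : EuclideanSpace ℝ (Fin d) | ξ ≠ 0}))
    (hdecomp : ∀ p ∈ K, ∀ ξ : EuclideanSpace ℝ (Fin d), ξ ≠ 0 →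
      A p ξ = ∑ l, (lam l p ξ : ℂ) • π l p ξ)
    (heig : ∀ l, ∀ p ∈ K, ∀ ξ : EuclideanSpace ℝ (Fin d), ξ ≠ 0 →
      A p ξ * π l p ξ = (lam l p ξ : ℂ) • π l p ξ) :
    ∀ n : ℕ,
    ∀ K₀ : Set (ℝ × EuclideanSpace ℝ (Fin d)), IsCompact K₀ → K₀ ⊆ K →
    ∀ Ξ : Set (EuclideanSpace ℝ (Fin d)), IsCompact Ξ → Ξ ⊆ {ξ | ξ ≠ 0} →
      ∃ C : ℝ, ∀ p ∈ K₀, ∀ ξ ∈ Ξ, ∀ η : EuclideanSpace ℝ (Fin d), ‖η‖ ≤ 1 →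
        (‖cext n (A p) ξ η -
            ∑ l, cext n (fun ζ => (lam l p ζ : ℂ)) ξ η • cext n (π l p) ξ η‖ ≤
          C * ‖η‖ ^ (n + 1)) ∧
        ∀ l, ‖cext n (A p) ξ η * cext n (π l p) ξ η -
            cext n (fun ζ => (lam l p ζ : ℂ)) ξ η • cext n (π l p) ξ η‖ ≤
          C * ‖η‖ ^ (n + 1) := by

  intro n K₀ hK₀ hK Ξ hΞ hΞU
  have hU : IsOpen {ξ : EuclideanSpace ℝ (Fin d) | ξ ≠ 0} := isOpen_ne
  let Bm : Matrix (Fin N) (Fin N) ℂ →L[ℝ] Matrix (Fin N) (Fin N) ℂ →L[ℝ]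
      Matrix (Fin N) (Fin N) ℂ :=
    (LinearMap.mul ℝ (Matrix (Fin N) (Fin N) ℂ)).toContinuousBilinearMap
  let Bs : ℂ →L[ℝ] Matrix (Fin N) (Fin N) ℂ →L[ℝ] Matrix (Fin N) (Fin N) ℂ :=
    ContinuousLinearMap.lsmul ℝ ℂ
  have hBm : ∀ x y, Bm x y = x * y := fun _ _ => rfl
  have hBs : ∀ x y, Bs x y = x • y := fun _ _ => rfl
  have hlam' : ∀ l, ContDiffOn ℝ (⊤ : ℕ∞)
      (fun w : (ℝ × EuclideanSpace ℝ (Fin d)) × EuclideanSpace ℝ (Fin d) =>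
        (lam l w.1 w.2 : ℂ)) (K ×ˢ {ξ : EuclideanSpace ℝ (Fin d) | ξ ≠ 0}) := fun l =>
    Complex.ofRealCLM.contDiff.comp_contDiffOn (hlam l)
  have e1 := fun l => family_err hU n Bs (fun x y => x • y) hBs (fun a b x y => by
    simp only [smul_eq_mul, smul_smul]; congr 1; ring)
    (f := fun p ζ => (lam l p ζ : ℂ)) (hlam' l) (hπ l) hK₀ hK hΞ hΞU
  have e2 := fun l => family_err hU n Bm (fun x y => x * y) hBm (fun a b x y => by
    simp only [smul_mul_smul_comm]) hA (hπ l) hK₀ hK hΞ hΞU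
  choose C1 hC1 using e1
  choose C2 hC2 using e2
  refine ⟨∑ l, |C1 l| + ∑ l, |C2 l|, fun p hp ξ hξ η hη => ⟨?_, fun l => ?_⟩⟩
  · have h1 : cext n (A p) ξ η = ∑ l, cext n (fun x => (lam l p x : ℂ) • π l p x) ξ η :=
      cext_decomp hU n (a := fun l x => (lam l p x : ℂ)) (g := fun l => π l p)
        (fun l => slice_smooth (f := fun p ζ => (lam l p ζ : ℂ)) (hlam' l) (hK hp))
        (fun l => slice_smooth (hπ l) (hK hp))
        (fun ζ hζ => hdecomp p (hK hp) ζ hζ) (hΞU hξ) η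
    rw [h1, ← Finset.sum_sub_distrib, add_mul, Finset.sum_mul]
    refine (norm_sum_le _ _).trans ?_
    refine le_add_of_le_of_nonneg (Finset.sum_le_sum fun l _ => ?_) (by positivity)
    rw [norm_sub_rev]
    refine (hC1 l p hp ξ hξ η hη).trans ?_
    gcongr
    exact le_abs_self _
  · have h1 : cext n (fun x => A p x * π l p x) ξ η =
        cext n (fun x => (lam l p x : ℂ) • π l p x) ξ η :=
      cext_congr hU n (fun ζ hζ => heig l p (hK hp) ζ hζ) (hΞU hξ) η
    have h2 := hC2 l p hp ξ hξ η hη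
    have h3 := hC1 l p hp ξ hξ η hη
    rw [← h1, norm_sub_rev] at h3
    refine (norm_sub_le_norm_sub_add_norm_sub _ _ _).trans ((add_le_add h2 h3).trans ?_)
    rw [← add_mul, add_comm (C2 l)]
    have a1 : C1 l ≤ ∑ l, |C1 l| := (le_abs_self _).trans
      (Finset.single_le_sum (f := fun l => |C1 l|) (fun _ _ => abs_nonneg _) (Finset.mem_univ l))
    have a2 : C2 l ≤ ∑ l, |C2 l| := (le_abs_self _).trans
      (Finset.single_le_sum (f := fun l => |C2 l|) (fun _ _ => abs_nonneg _) (Finset.mem_univ l))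
    gcongr
end
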